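/- Let A be a multiplicative divisor system with n ∈ A(n) for all n, and let φ_A be the unique multiplicative function satisfying ∑_{d ∈ A(n)} φ_A(d) = n. Assume for each prime p > 2 there exists e_p with p^{e_p − 1} ∈ A(p^{e_p}) and e_p = p^{o(1)}. Then liminf_{n→∞} φ_A(n)·log log n / n = e^{-γ} · ∏_p (1 − 1/p)^{-1} · inf_{ν≥0} φ_A(p^ν)/p^ν, where the product converges for p > 2 (the factor at p = 2 may vanish). -/

import Mathlib

open Filter Real
open scoped Pointwise
open Topology MeasureTheory

/-- Mertens' first theorem, in terms of the von Mangoldt function. -/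
lemma abs_sum_vonMangoldt_div_sub_log_le :
    ∃ C : ℝ, ∀ n : ℕ, 1 ≤ n →
      |∑ k ∈ Finset.Ioc 0 n, ArithmeticFunction.vonMangoldt k / k - log n| ≤ C := by
  refine ⟨log 4 + 5, fun n hn ↦ ?_⟩
  have hn0 : (0 : ℝ) < n := by exact_mod_cast hn
  have hfac : log (n.factorial) =
      ∑ k ∈ Finset.Ioc 0 n, ArithmeticFunction.vonMangoldt k * ((n / k : ℕ) : ℝ) := by
    rw [← ArithmeticFunction.sum_Ioc_mul_zeta_eq_sum, ArithmeticFunction.vonMangoldt_mul_zeta,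
      ← Finset.prod_Ico_id_eq_factorial, Nat.cast_prod, log_prod]
    · rfl
    · intro i hi
      have := (Finset.mem_Ico.1 hi).1
      positivity
  have hup : log (n.factorial) ≤ n * log n := by
    rw [← log_pow]
    exact log_le_log (by positivity) (by exact_mod_cast Nat.factorial_le_pow n)
  have hlow : n * log n - n ≤ log (n.factorial) := by
    have h := Stirling.le_log_factorial_stirling (n := n) (by omega)
    have h1 : 0 ≤ log n := log_natCast_nonneg n
    have h2 : 0 ≤ log (2 * π) := log_nonneg (by nlinarith [pi_gt_three])
    linarith
  have hmain : n * ∑ k ∈ Finset.Ioc 0 n, ArithmeticFunction.vonMangoldt k / k =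
      ∑ k ∈ Finset.Ioc 0 n, ArithmeticFunction.vonMangoldt k * ((n : ℝ) / k) := by
    rw [Finset.mul_sum]
    exact Finset.sum_congr rfl fun k _ ↦ by ring
  have h1 : log (n.factorial) ≤
      n * ∑ k ∈ Finset.Ioc 0 n, ArithmeticFunction.vonMangoldt k / k := by
    rw [hfac, hmain]
    exact Finset.sum_le_sum fun k _ ↦
      mul_le_mul_of_nonneg_left Nat.cast_div_le ArithmeticFunction.vonMangoldt_nonneg
  have h2 : n * ∑ k ∈ Finset.Ioc 0 n, ArithmeticFunction.vonMangoldt k / k ≤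
      log (n.factorial) + (log 4 + 4) * n := by
    refine le_trans ?_ (add_le_add_right (Chebyshev.psi_le_const_mul_self hn0.le) _)
    rw [hfac, hmain, Chebyshev.psi, Nat.floor_natCast, ← Finset.sum_add_distrib]
    refine Finset.sum_le_sum fun k hk ↦ ?_
    have h3 : (n : ℝ) / k ≤ ((n / k : ℕ) : ℝ) + 1 := by
      rw [← Nat.floor_div_eq_div (K := ℝ)]
      exact (Nat.lt_floor_add_one _).le
    have := mul_le_mul_of_nonneg_left h3
      (ArithmeticFunction.vonMangoldt_nonneg (n := k))
    linarith
  set S := ∑ k ∈ Finset.Ioc 0 n, ArithmeticFunction.vonMangoldt k / k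
  have h4 : 0 ≤ log 4 := log_nonneg (by norm_num)
  rw [abs_le]
  constructor
  · refine le_of_mul_le_mul_left ?_ hn0
    nlinarith
  · refine le_of_mul_le_mul_left ?_ hn0
    nlinarith

lemma summable_vonMangoldt_div_of_not_prime :
    Summable fun n : ℕ ↦ (if n.Prime then 0 else ArithmeticFunction.vonMangoldt n) / n := by
  refine (ArithmeticFunction.vonMangoldt.summable_residueClass_non_primes_div
    (q := 1) (a := 0)).congr fun n ↦ ?_
  have : ArithmeticFunction.vonMangoldt.residueClass (0 : ZMod 1) n =
      ArithmeticFunction.vonMangoldt n := by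
    unfold ArithmeticFunction.vonMangoldt.residueClass
    rw [Set.indicator_of_mem]
    exact Subsingleton.elim _ _
  rw [this]

lemma le_neg_log_one_sub {x : ℝ} (hx : x < 1) : x ≤ -log (1 - x) := by
  have := log_le_sub_one_of_pos (sub_pos.2 hx)
  linarith

lemma neg_log_one_sub_le {x : ℝ} (hx : x ≤ 1 / 2) :
    -log (1 - x) ≤ x + 2 * x ^ 2 := by
  have h1 : 0 < 1 - x := by linarith
  have := one_sub_inv_le_log_of_pos h1
  have h2 : (1 - x)⁻¹ ≤ 1 + x + 2 * x ^ 2 := by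
    rw [inv_le_iff_one_le_mul₀ h1]
    nlinarith [mul_nonneg (sq_nonneg x) (by linarith : 0 ≤ 1 - 2 * x)]
  linarith

lemma summable_log_div_sq : Summable fun n : ℕ ↦ log n / (n : ℝ) ^ 2 := by
  refine Summable.of_nonneg_of_le (fun n ↦ by positivity) (fun n ↦ ?_)
    ((summable_nat_rpow.2 (by norm_num : (-(3 / 2) : ℝ) < -1)).mul_left 2)
  rcases Nat.eq_zero_or_pos n with rfl | hn
  · simp
  have hn0 : (0 : ℝ) < n := by exact_mod_cast hn
  have h := log_le_rpow_div hn0.le (ε := 1 / 2) (by norm_num)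
  rw [div_le_iff₀ (by positivity), mul_assoc, ← rpow_natCast, ← rpow_add hn0]
  norm_num at h ⊢
  linarith

lemma inv_prime_le_half {p : ℕ} (hp : p.Prime) : (1 : ℝ) / p ≤ 1 / 2 :=
  one_div_le_one_div_of_le (by norm_num) (by exact_mod_cast hp.two_le)

/-- Mertens' first theorem, with weights adapted to the Euler product. -/
lemma abs_sum_neg_log_mul_log_sub_log_le :
    ∃ C : ℝ, ∀ n : ℕ, 1 ≤ n →
      |∑ p ∈ Nat.primesLE n, -log (1 - 1 / (p : ℝ)) * log p - log n| ≤ C := by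
  obtain ⟨C, hC⟩ := abs_sum_vonMangoldt_div_sub_log_le
  refine ⟨C + (∑' n : ℕ, (if n.Prime then 0 else ArithmeticFunction.vonMangoldt n) / (n : ℝ)) +
    2 * ∑' n : ℕ, log n / (n : ℝ) ^ 2, fun n hn ↦ ?_⟩
  have h1 : ∑ k ∈ Finset.Ioc 0 n, ArithmeticFunction.vonMangoldt k / k =
      ∑ p ∈ Nat.primesLE n, log p / p +
      ∑ k ∈ Finset.Ioc 0 n, (if k.Prime then 0 else ArithmeticFunction.vonMangoldt k) / (k : ℝ) := by
    rw [Nat.primesLE_eq_filter_Ioc_zero, Finset.sum_filter, ← Finset.sum_add_distrib]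
    refine Finset.sum_congr rfl fun k _ ↦ ?_
    split_ifs with hk
    · simp [ArithmeticFunction.vonMangoldt_apply_prime hk]
    · simp
  have hnn (k : ℕ) : 0 ≤ (if k.Prime then 0 else ArithmeticFunction.vonMangoldt k) / (k : ℝ) := by
    split_ifs
    · simp
    · exact div_nonneg ArithmeticFunction.vonMangoldt_nonneg (by positivity)
  have h2 := summable_vonMangoldt_div_of_not_prime.sum_le_tsum (Finset.Ioc 0 n)
    fun k _ ↦ hnn k
  have h2' := Finset.sum_nonneg (s := Finset.Ioc 0 n) fun k _ ↦ hnn k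
  have h3 := summable_log_div_sq.sum_le_tsum (Nat.primesLE n) fun k _ ↦ by positivity
  have h4 : ∑ p ∈ Nat.primesLE n, log p / (p : ℝ) ≤
      ∑ p ∈ Nat.primesLE n, -log (1 - 1 / (p : ℝ)) * log p := by
    refine Finset.sum_le_sum fun p hp ↦ ?_
    have hp := Nat.prime_of_mem_primesLE hp
    have := mul_le_mul_of_nonneg_right
      (le_neg_log_one_sub ((inv_prime_le_half hp).trans_lt (by norm_num)))
      (log_natCast_nonneg p)
    rwa [one_div_mul_eq_div] at this
  have h5 : ∑ p ∈ Nat.primesLE n, -log (1 - 1 / (p : ℝ)) * log p ≤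
      ∑ p ∈ Nat.primesLE n, log p / (p : ℝ) +
        2 * ∑ p ∈ Nat.primesLE n, log p / (p : ℝ) ^ 2 := by
    rw [Finset.mul_sum, ← Finset.sum_add_distrib]
    refine Finset.sum_le_sum fun p hp ↦ ?_
    have hp := Nat.prime_of_mem_primesLE hp
    have := mul_le_mul_of_nonneg_right
      (neg_log_one_sub_le (inv_prime_le_half hp)) (log_natCast_nonneg p)
    refine this.trans (le_of_eq ?_)
    ring
  have h6 := abs_le.1 (hC n hn)
  have h7 : 0 ≤ ∑' n : ℕ, log n / (n : ℝ) ^ 2 := tsum_nonneg fun k ↦ by positivity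
  rw [abs_le]
  constructor <;> linarith

/-- Mertens' second theorem: the logarithm of the Euler product over `p ≤ n`, minus
`log (log n)`, converges. -/
lemma exists_tendsto_sum_neg_log_sub_log_log :
    ∃ C : ℝ, Tendsto (fun n : ℕ ↦ ∑ p ∈ Nat.primesLE n, -log (1 - 1 / (p : ℝ)) - log (log n))
      atTop (𝓝 C) := by
  obtain ⟨C, hC⟩ := abs_sum_neg_log_mul_log_sub_log_le
  set P : ℕ → ℝ := fun n ↦ ∑ p ∈ Nat.primesLE n, -log (1 - 1 / (p : ℝ)) with hP
  set R : ℕ → ℝ := fun n ↦ ∑ p ∈ Nat.primesLE n, -log (1 - 1 / (p : ℝ)) * log p - log n with hR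
  have hC0 : 0 ≤ C := (abs_nonneg _).trans (hC 1 le_rfl)
  have hlogpos (n : ℕ) : 0 < log ((n + 2 : ℕ) : ℝ) := log_pos (by norm_cast; omega)
  set Q : ℕ → ℝ := fun n ↦ P (n + 2) - log (log (n + 2 : ℕ)) - R (n + 2) / log (n + 2 : ℕ) with hQ
  have hstep (n : ℕ) : dist (Q n) (Q (n + 1)) ≤
      (C + 1) * ((log (n + 2 : ℕ))⁻¹ - (log (n + 1 + 2 : ℕ))⁻¹) := by
    have hL := hlogpos n
    have hL' := hlogpos (n + 1)
    have hRn := hC (n + 2) (by omega)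
    have hPR : R (n + 1 + 2) - R (n + 2) + (log (n + 1 + 2 : ℕ) - log (n + 2 : ℕ)) =
        (P (n + 1 + 2) - P (n + 2)) * log (n + 1 + 2 : ℕ) := by
      simp only [hR, hP]
      rw [show n + 1 + 2 = (n + 2) + 1 by ring, Nat.primesLE_succ]
      split_ifs with hp
      · rw [Finset.sum_insert (Nat.notMem_primesLE _), Finset.sum_insert (Nat.notMem_primesLE _)]
        ring
      · ring
    change |R (n + 2)| ≤ C at hRn
    have hΔ0 : log (n + 2 : ℕ) ≤ log (n + 1 + 2 : ℕ) :=
      log_le_log (by positivity) (by norm_cast; omega)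
    have hΔ1 : log (n + 1 + 2 : ℕ) - log (n + 2 : ℕ) ≤ 1 := by
      rw [← log_div (by positivity) (by positivity)]
      refine (log_le_sub_one_of_pos (by positivity)).trans ?_
      rw [sub_le_iff_le_add, div_le_iff₀ (by positivity)]
      push_cast
      linarith [(Nat.cast_nonneg n : (0 : ℝ) ≤ n)]
    have hdiff : Q n - Q (n + 1) = log (log (n + 1 + 2 : ℕ) / log (n + 2 : ℕ)) -
        (log (n + 1 + 2 : ℕ) - log (n + 2 : ℕ)) / log (n + 1 + 2 : ℕ) -
        R (n + 2) * ((log (n + 2 : ℕ))⁻¹ - (log (n + 1 + 2 : ℕ))⁻¹) := by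
      rw [log_div hL'.ne' hL.ne']
      have h1 : P (n + 1 + 2) = P (n + 2) + (R (n + 1 + 2) - R (n + 2) +
          (log (n + 1 + 2 : ℕ) - log (n + 2 : ℕ))) / log (n + 1 + 2 : ℕ) := by
        rw [hPR]; field_simp; ring
      simp only [hQ]
      rw [h1]
      field_simp
      ring
    set L := log (n + 2 : ℕ)
    set L' := log (n + 1 + 2 : ℕ)
    have hinv : 0 ≤ L⁻¹ - L'⁻¹ := sub_nonneg.2 (inv_anti₀ hL hΔ0)
    have hup : log (L' / L) ≤ L' / L - 1 := log_le_sub_one_of_pos (by positivity)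
    have hlow : 1 - (L' / L)⁻¹ ≤ log (L' / L) := one_sub_inv_le_log_of_pos (by positivity)
    have e1 : L' / L - 1 = (L' - L) / L' + (L' - L) * (L⁻¹ - L'⁻¹) := by field_simp; ring
    have e2 : 1 - (L' / L)⁻¹ = (L' - L) / L' := by field_simp
    have h3 : (L' - L) * (L⁻¹ - L'⁻¹) ≤ 1 * (L⁻¹ - L'⁻¹) := by gcongr
    have h4 : |R (n + 2) * (L⁻¹ - L'⁻¹)| ≤ C * (L⁻¹ - L'⁻¹) := by
      rw [abs_mul, abs_of_nonneg hinv]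
      gcongr
    rw [dist_eq, hdiff]
    rw [abs_le] at h4 ⊢
    constructor <;> linarith
  have hsum : Summable fun n : ℕ ↦ (C + 1) *
      ((log (n + 2 : ℕ))⁻¹ - (log (n + 1 + 2 : ℕ))⁻¹) := by
    refine Summable.mul_left _ (summable_of_sum_range_le (c := (log (0 + 2 : ℕ))⁻¹)
      (fun n ↦ sub_nonneg.2 (inv_anti₀ (hlogpos n) (log_le_log (by positivity)
        (by norm_cast; omega)))) fun n ↦ ?_)
    rw [Finset.sum_range_sub' (fun n : ℕ ↦ (log (n + 2 : ℕ))⁻¹)]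
    linarith [inv_pos.2 (hlogpos n)]
  obtain ⟨c, hc⟩ := cauchySeq_tendsto_of_complete
    (cauchySeq_of_dist_le_of_summable _ hstep hsum)
  have hR0 : Tendsto (fun n : ℕ ↦ R (n + 2) / log (n + 2 : ℕ)) atTop (𝓝 0) := by
    have hlog : Tendsto (fun n : ℕ ↦ C / log (n + 2 : ℕ)) atTop (𝓝 0) :=
      Tendsto.const_div_atTop (tendsto_log_atTop.comp
        (tendsto_natCast_atTop_atTop.comp (tendsto_add_atTop_nat 2))) _
    refine squeeze_zero_norm (fun n ↦ ?_) hlog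
    rw [norm_div, norm_eq_abs, norm_eq_abs, abs_of_pos (hlogpos n)]
    have := hC (n + 2) (by omega)
    have hL := hlogpos n
    gcongr
  refine ⟨c, (tendsto_add_atTop_iff_nat 2).1 ?_⟩
  have := hc.add hR0
  rw [add_zero] at this
  exact this.congr fun n ↦ by simp only [hQ]; ring

lemma abs_log_le_add_rpow {v : ℝ} (hv : 0 < v) : |log v| ≤ v + 2 * v ^ (-(1 / 2) : ℝ) := by
  have h1 := log_le_sub_one_of_pos hv
  have h2 := log_le_rpow_div (inv_pos.2 hv).le (ε := 1 / 2) (by norm_num)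
  rw [log_inv, inv_rpow hv.le, ← rpow_neg hv.le] at h2
  have h3 : 0 < v ^ (-(1 / 2) : ℝ) := by positivity
  rw [abs_le]
  constructor <;> linarith

lemma integrableOn_abs_log_mul_exp_neg :
    IntegrableOn (fun v : ℝ ↦ |log v| * exp (-v)) (Set.Ioi 0) := by
  have h1 := GammaIntegral_convergent (s := 2) (by norm_num)
  have h2 := (GammaIntegral_convergent (s := 1 / 2) (by norm_num)).const_mul 2
  refine (h1.add h2).mono' (by fun_prop) ?_
  refine (ae_restrict_iff' measurableSet_Ioi).2 (ae_of_all _ fun v hv ↦ ?_)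
  have hv : 0 < v := hv
  rw [norm_mul, norm_eq_abs, abs_abs, norm_of_nonneg (exp_pos _).le, Pi.add_apply]
  have := mul_le_mul_of_nonneg_right (abs_log_le_add_rpow hv) (exp_pos (-v)).le
  norm_num at this ⊢
  linarith

lemma integrableOn_log_mul_exp_neg :
    IntegrableOn (fun v : ℝ ↦ log v * exp (-v)) (Set.Ioi 0) := by
  refine Integrable.mono integrableOn_abs_log_mul_exp_neg (by fun_prop) (ae_of_all _ fun v ↦ ?_)
  simp

lemma integral_log_mul_exp_neg :
    ∫ v in Set.Ioi (0 : ℝ), log v * exp (-v) = -eulerMascheroniConstant := by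
  have h1 := Complex.hasDerivAt_GammaIntegral (s := 1) (by norm_num)
  have h2 : HasDerivAt Complex.GammaIntegral (-eulerMascheroniConstant) 1 := by
    refine Complex.hasDerivAt_Gamma_one.congr_of_eventuallyEq ?_
    have : ∀ᶠ s : ℂ in 𝓝 1, 0 < s.re :=
      Complex.continuous_re.continuousAt.eventually (lt_mem_nhds (by norm_num))
    filter_upwards [this] with s hs using (Complex.Gamma_eq_integral hs).symm
  have h3 := h1.unique h2
  have h4 : ∫ t : ℝ in Set.Ioi 0, (t : ℂ) ^ ((1 : ℂ) - 1) * (Real.log t * Real.exp (-t)) =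
      ((∫ v in Set.Ioi (0 : ℝ), log v * exp (-v) : ℝ) : ℂ) := by
    rw [← integral_complex_ofReal]
    simp
  rw [h4] at h3
  exact_mod_cast h3

lemma neg_log_one_sub_inv_nonneg {p : ℕ} (hp : p.Prime) : 0 ≤ -log (1 - 1 / (p : ℝ)) :=
  le_trans (by positivity) (le_neg_log_one_sub ((inv_prime_le_half hp).trans_lt (by norm_num)))

lemma neg_log_one_sub_inv_le {p : ℕ} (hp : p.Prime) : -log (1 - 1 / (p : ℝ)) ≤ 2 / p := by
  refine (neg_log_one_sub_le (inv_prime_le_half hp)).trans ?_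
  have h1 : (1 / p : ℝ) ^ 2 ≤ 1 / 2 * (1 / p) := by
    rw [sq]
    exact mul_le_mul_of_nonneg_right (inv_prime_le_half hp) (by positivity)
  have h2 : (2 / p : ℝ) = 2 * (1 / p) := by ring
  linarith

lemma summable_neg_log_mul_rpow {s : ℝ} (hs : 0 < s) :
    Summable fun p : Nat.Primes ↦ -log (1 - 1 / (p : ℝ)) * (p : ℝ) ^ (-s) := by
  refine Summable.of_nonneg_of_le
    (fun p ↦ mul_nonneg (neg_log_one_sub_inv_nonneg p.2) (by positivity)) (fun p ↦ ?_)
    ((Nat.Primes.summable_rpow.2 (by linarith : -(1 + s) < -1)).mul_left 2)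
  have hp : (0 : ℝ) < p := by exact_mod_cast p.2.pos
  refine (mul_le_mul_of_nonneg_right (neg_log_one_sub_inv_le p.2) (by positivity)).trans_eq ?_
  rw [neg_add, rpow_add hp, rpow_neg_one]
  ring

/-- The prime sum as a Laplace transform of its summatory function. -/
lemma tsum_neg_log_mul_rpow_eq_integral {s : ℝ} (hs : 0 < s) :
    ∑' p : Nat.Primes, -log (1 - 1 / (p : ℝ)) * (p : ℝ) ^ (-s) =
      ∫ v in Set.Ioi (0 : ℝ),
        (∑ p ∈ Nat.primesLE ⌊exp (v / s)⌋₊, -log (1 - 1 / (p : ℝ))) * exp (-v) := by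
  set F : Nat.Primes → ℝ → ℝ := fun p ↦
    (Set.Ioi (s * log p)).indicator fun v ↦ -log (1 - 1 / (p : ℝ)) * exp (-v) with hF
  have hlog (p : Nat.Primes) : 0 < s * log p :=
    mul_pos hs (log_pos (by exact_mod_cast p.2.one_lt))
  have hsub (p : Nat.Primes) : Set.Ioi (s * log p) ⊆ Set.Ioi 0 :=
    Set.Ioi_subset_Ioi (hlog p).le
  have hint (p : Nat.Primes) : IntegrableOn (F p) (Set.Ioi 0) := by
    refine IntegrableOn.indicator ?_ measurableSet_Ioi
    exact (integrableOn_exp_neg_Ioi 0).const_mul _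
  have hval (p : Nat.Primes) : ∫ v in Set.Ioi (0 : ℝ), F p v =
      -log (1 - 1 / (p : ℝ)) * (p : ℝ) ^ (-s) := by
    have hp : (0 : ℝ) < p := by exact_mod_cast p.2.pos
    rw [hF, setIntegral_indicator measurableSet_Ioi, Set.inter_eq_right.2 (hsub p),
      integral_const_mul, integral_exp_neg_Ioi, rpow_def_of_pos hp]
    ring_nf
  have hnorm (p : Nat.Primes) : ∫ v in Set.Ioi (0 : ℝ), ‖F p v‖ =
      -log (1 - 1 / (p : ℝ)) * (p : ℝ) ^ (-s) := by
    rw [← hval p]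
    refine integral_congr_ae (ae_of_all _ fun v ↦ norm_of_nonneg ?_)
    exact Set.indicator_nonneg
      (fun v _ ↦ mul_nonneg (neg_log_one_sub_inv_nonneg p.2) (exp_pos _).le) v
  have h := hasSum_integral_of_summable_integral_norm hint
    ((summable_neg_log_mul_rpow hs).congr fun p ↦ (hnorm p).symm)
  simp_rw [hval] at h
  rw [h.tsum_eq]
  have hne : ∀ᵐ v : ℝ, ∀ p : Nat.Primes, v ≠ s * log p :=
    ae_all_iff.2 fun p ↦ Measure.ae_ne volume _
  refine setIntegral_congr_ae measurableSet_Ioi ?_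
  filter_upwards [hne] with v hv _
  have hmem (p : Nat.Primes) : (p : ℕ) ∈ Nat.primesLE ⌊exp (v / s)⌋₊ ↔ v ∈ Set.Ioi (s * log p) := by
    have hp : (0 : ℝ) < p := by exact_mod_cast p.2.pos
    rw [Nat.mem_primesLE, and_iff_left p.2, Nat.le_floor_iff (exp_pos _).le,
      ← log_le_iff_le_exp hp, le_div_iff₀ hs, Set.mem_Ioi, mul_comm]
    exact ⟨fun h ↦ lt_of_le_of_ne h (hv p).symm, le_of_lt⟩
  rw [Finset.sum_mul, ← Finset.sum_subtype_of_mem (p := Nat.Prime)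
    (fun p : ℕ ↦ -log (1 - 1 / (p : ℝ)) * exp (-v)) fun p hp ↦ Nat.prime_of_mem_primesLE hp]
  have hmem' (p : Nat.Primes) : p ∈ Finset.subtype Nat.Prime (Nat.primesLE ⌊exp (v / s)⌋₊) ↔
      v ∈ Set.Ioi (s * log p) := Finset.mem_subtype.trans (hmem p)
  refine (tsum_eq_sum (β := Nat.Primes)
    (s := Finset.subtype Nat.Prime (Nat.primesLE ⌊exp (v / s)⌋₊)) fun p hp ↦ ?_).trans
    (Finset.sum_congr rfl fun p hp ↦ ?_)
  · exact Set.indicator_of_notMem (fun h ↦ hp ((hmem' p).2 h)) _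
  · exact Set.indicator_of_mem ((hmem' p).1 hp) _

lemma log_sub_log_log_floor_exp_mem {u : ℝ} (hu : log 2 ≤ u) :
    0 ≤ log u - log (log ⌊exp u⌋₊) ∧ log u - log (log ⌊exp u⌋₊) ≤ 1 / log ⌊exp u⌋₊ := by
  have h2 : (2 : ℝ) ≤ exp u := (log_le_iff_le_exp (by norm_num)).1 hu
  have hn2 : 2 ≤ ⌊exp u⌋₊ := Nat.le_floor (by exact_mod_cast h2)
  have hn : (0 : ℝ) < ⌊exp u⌋₊ := by positivity
  have hlog : 0 < log ⌊exp u⌋₊ := log_pos (by exact_mod_cast hn2)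
  have hle : log ⌊exp u⌋₊ ≤ u := by
    rw [log_le_iff_le_exp hn]
    exact Nat.floor_le (exp_pos _).le
  have hle' : u ≤ log ⌊exp u⌋₊ + 1 := by
    have h3 : u ≤ log (⌊exp u⌋₊ + 1) := by
      rw [le_log_iff_exp_le (by positivity)]
      exact (Nat.lt_floor_add_one _).le
    have h4 : log (⌊exp u⌋₊ + 1) - log ⌊exp u⌋₊ ≤ 1 := by
      rw [← log_div (by positivity) (by positivity)]
      refine (log_le_sub_one_of_pos (by positivity)).trans ?_
      rw [sub_le_iff_le_add, div_le_iff₀ (by positivity)]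
      have : (2 : ℝ) ≤ ⌊exp u⌋₊ := by exact_mod_cast hn2
      linarith
    linarith
  refine ⟨sub_nonneg.2 (log_le_log hlog hle), ?_⟩
  rw [← log_div (hlog.trans_le hle).ne' hlog.ne']
  refine (log_le_sub_one_of_pos (div_pos (hlog.trans_le hle) hlog)).trans ?_
  rw [sub_le_iff_le_add, div_add_one hlog.ne']
  gcongr
  linarith

lemma tendsto_sum_floor_exp_sub_log {C : ℝ}
    (hC : Tendsto (fun n : ℕ ↦ ∑ p ∈ Nat.primesLE n, -log (1 - 1 / (p : ℝ)) - log (log n))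
      atTop (𝓝 C)) :
    Tendsto (fun u : ℝ ↦ ∑ p ∈ Nat.primesLE ⌊exp u⌋₊, -log (1 - 1 / (p : ℝ)) - log u)
      atTop (𝓝 C) := by
  have hfl : Tendsto (fun u : ℝ ↦ ⌊exp u⌋₊) atTop atTop :=
    tendsto_nat_floor_atTop.comp tendsto_exp_atTop
  have h1 : Tendsto (fun u : ℝ ↦ 1 / log (⌊exp u⌋₊ : ℝ)) atTop (𝓝 0) :=
    Tendsto.const_div_atTop (tendsto_log_atTop.comp (tendsto_natCast_atTop_atTop.comp hfl)) _
  have h2 : Tendsto (fun u : ℝ ↦ log u - log (log (⌊exp u⌋₊ : ℝ))) atTop (𝓝 0) := by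
    refine squeeze_zero' ?_ ?_ h1 <;> filter_upwards [eventually_ge_atTop (log 2)] with u hu
    exacts [(log_sub_log_log_floor_exp_mem hu).1, (log_sub_log_log_floor_exp_mem hu).2]
  have h3 := (hC.comp hfl).sub h2
  rw [sub_zero] at h3
  refine h3.congr fun u ↦ ?_
  simp

lemma exists_abs_sum_floor_exp_sub_log_le {C : ℝ}
    (hC : Tendsto (fun n : ℕ ↦ ∑ p ∈ Nat.primesLE n, -log (1 - 1 / (p : ℝ)) - log (log n))
      atTop (𝓝 C)) :
    ∃ B : ℝ, 0 ≤ B ∧ ∀ u : ℝ, log 2 ≤ u →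
      |∑ p ∈ Nat.primesLE ⌊exp u⌋₊, -log (1 - 1 / (p : ℝ)) - log u| ≤ B := by
  obtain ⟨B, hB⟩ := hC.norm.bddAbove_range
  have hB' (n : ℕ) : |∑ p ∈ Nat.primesLE n, -log (1 - 1 / (p : ℝ)) - log (log n)| ≤ B :=
    hB ⟨n, rfl⟩
  have hl2 : 0 < log 2 := log_pos (by norm_num)
  refine ⟨B + 1 / log 2, add_nonneg ((abs_nonneg _).trans (hB' 0)) (by positivity),
    fun u hu ↦ ?_⟩
  obtain ⟨h1, h2⟩ := log_sub_log_log_floor_exp_mem hu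
  have h3 : log 2 ≤ log ⌊exp u⌋₊ := by
    refine log_le_log (by norm_num) ?_
    have : 2 ≤ ⌊exp u⌋₊ := Nat.le_floor (by
      exact_mod_cast (log_le_iff_le_exp (by norm_num)).1 hu)
    exact_mod_cast this
  have h4 : 1 / log ⌊exp u⌋₊ ≤ 1 / log 2 := one_div_le_one_div_of_le hl2 h3
  have h5 := abs_le.1 (hB' ⌊exp u⌋₊)
  rw [abs_le]
  constructor <;> linarith

lemma tendsto_tsum_neg_log_mul_rpow_add_log {C : ℝ}
    (hC : Tendsto (fun n : ℕ ↦ ∑ p ∈ Nat.primesLE n, -log (1 - 1 / (p : ℝ)) - log (log n))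
      atTop (𝓝 C)) :
    Tendsto (fun s : ℝ ↦
        ∑' p : Nat.Primes, -log (1 - 1 / (p : ℝ)) * (p : ℝ) ^ (-s) + log s)
      (𝓝[>] 0) (𝓝 (C - eulerMascheroniConstant)) := by
  set D : ℝ → ℝ := fun u ↦ ∑ p ∈ Nat.primesLE ⌊exp u⌋₊, -log (1 - 1 / (p : ℝ)) - log u with hD
  have hDm : Measurable D := by
    refine Measurable.sub ?_ measurable_log
    exact (measurable_from_nat (f := fun n ↦ ∑ p ∈ Nat.primesLE n, -log (1 - 1 / (p : ℝ)))).comp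
      (Nat.measurable_floor.comp measurable_exp)
  obtain ⟨B, hB0, hB⟩ := exists_abs_sum_floor_exp_sub_log_le hC
  have hsmall {u : ℝ} (hu : u < log 2) : D u = -log u := by
    have : ⌊exp u⌋₊ < 2 := by
      rw [Nat.floor_lt (exp_pos _).le]
      exact_mod_cast (lt_log_iff_exp_lt (by norm_num)).1 hu
    have h0 : Nat.primesLE ⌊exp u⌋₊ = ∅ := by
      refine Finset.eq_empty_of_forall_notMem fun p hp ↦ ?_
      have := Nat.two_le_of_mem_primesLE hp
      have := Nat.le_of_mem_primesLE hp
      omega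
    simp [hD, h0]
  have hbound {s v : ℝ} (hs : 0 < s) (hs1 : s ≤ 1) (hv : 0 < v) :
      ‖D (v / s) * exp (-v)‖ ≤ B * exp (-v) + |log v| * exp (-v) := by
    rw [norm_mul, norm_of_nonneg (exp_pos _).le, ← add_mul]
    refine mul_le_mul_of_nonneg_right ?_ (exp_pos _).le
    rw [norm_eq_abs]
    rcases le_or_gt (log 2) (v / s) with h | h
    · exact (hB _ h).trans (le_add_of_nonneg_right (abs_nonneg _))
    · rw [hsmall h, abs_neg]
      have h1 : v ≤ v / s := le_div_self hv.le hs hs1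
      have h2 : v / s < 1 := h.trans (log_two_lt_d9.trans (by norm_num))
      have h3 : log v ≤ log (v / s) := log_le_log hv h1
      have h4 : log (v / s) ≤ 0 := log_nonpos (by positivity) h2.le
      rw [abs_of_nonpos h4, abs_of_nonpos (h3.trans h4)]
      linarith
  have hexp := integrableOn_exp_neg_Ioi 0
  have hbint : IntegrableOn (fun v ↦ B * exp (-v) + |log v| * exp (-v)) (Set.Ioi 0) :=
    (hexp.const_mul B).add integrableOn_abs_log_mul_exp_neg
  have hmeas (s : ℝ) : AEStronglyMeasurable (fun v ↦ D (v / s) * exp (-v))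
      (volume.restrict (Set.Ioi 0)) :=
    ((hDm.comp (measurable_id.div_const s)).mul (by fun_prop)).aestronglyMeasurable
  have hs01 : ∀ᶠ s : ℝ in 𝓝[>] 0, 0 < s ∧ s ≤ 1 := by
    filter_upwards [Ioc_mem_nhdsGT (zero_lt_one' ℝ)] with s hs using hs
  have hlim : Tendsto (fun s : ℝ ↦ ∫ v in Set.Ioi (0 : ℝ), D (v / s) * exp (-v))
      (𝓝[>] 0) (𝓝 (∫ v in Set.Ioi (0 : ℝ), C * exp (-v))) := by
    refine tendsto_integral_filter_of_dominated_convergence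
      (fun v ↦ B * exp (-v) + |log v| * exp (-v)) (Eventually.of_forall hmeas) ?_ hbint ?_
    · filter_upwards [hs01] with s hs
      exact (ae_restrict_iff' measurableSet_Ioi).2 (ae_of_all _ fun v hv ↦ hbound hs.1 hs.2 hv)
    · refine (ae_restrict_iff' measurableSet_Ioi).2 (ae_of_all _ fun v hv ↦ ?_)
      refine Tendsto.mul_const _ ((tendsto_sum_floor_exp_sub_log hC).comp ?_)
      exact tendsto_inv_nhdsGT_zero.const_mul_atTop hv
  rw [integral_const_mul, integral_exp_neg_Ioi_zero, mul_one] at hlim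
  refine (hlim.sub_const eulerMascheroniConstant).congr' ?_
  filter_upwards [hs01] with s hs
  have hDint : IntegrableOn (fun v ↦ D (v / s) * exp (-v)) (Set.Ioi 0) :=
    hbint.mono' (hmeas s)
      ((ae_restrict_iff' measurableSet_Ioi).2 (ae_of_all _ fun v hv ↦ hbound hs.1 hs.2 hv))
  have key : ∫ v in Set.Ioi (0 : ℝ),
      (∑ p ∈ Nat.primesLE ⌊exp (v / s)⌋₊, -log (1 - 1 / (p : ℝ))) * exp (-v) =
      ∫ v in Set.Ioi (0 : ℝ), (D (v / s) * exp (-v) + log v * exp (-v) - log s * exp (-v)) := by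
    refine setIntegral_congr_fun measurableSet_Ioi fun v hv ↦ ?_
    have hv : 0 < v := hv
    simp only [hD]
    rw [log_div hv.ne' hs.1.ne']
    ring
  have hadd : IntegrableOn (fun v ↦ D (v / s) * exp (-v) + log v * exp (-v)) (Set.Ioi 0) :=
    hDint.add integrableOn_log_mul_exp_neg
  rw [tsum_neg_log_mul_rpow_eq_integral hs.1, key, integral_sub hadd (hexp.const_mul _),
    integral_add hDint integrableOn_log_mul_exp_neg, integral_log_mul_exp_neg,
    integral_const_mul, integral_exp_neg_Ioi_zero]
  ring

lemma log_riemannZeta_re_eq_tsum {s : ℝ} (hs : 0 < s) :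
    log (riemannZeta ((1 + s : ℝ) : ℂ)).re =
      ∑' p : Nat.Primes, -log (1 - (p : ℝ) ^ (-(1 + s))) := by
  have h := riemannZeta_eulerProduct_exp_log (s := ((1 + s : ℝ) : ℂ)) (by simpa using hs)
  have hterm (p : Nat.Primes) : -Complex.log (1 - (p : ℂ) ^ (-((1 + s : ℝ) : ℂ))) =
      ((-log (1 - (p : ℝ) ^ (-(1 + s))) : ℝ) : ℂ) := by
    have hp : (1 : ℝ) < p := by exact_mod_cast p.2.one_lt
    have h1 : (p : ℝ) ^ (-(1 + s)) ≤ 1 := rpow_le_one_of_one_le_of_nonpos hp.le (by linarith)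
    rw [Complex.ofReal_neg, Complex.ofReal_log (by linarith), Complex.ofReal_sub,
      Complex.ofReal_one, Complex.ofReal_cpow (by positivity)]
    simp
  simp_rw [hterm] at h
  rw [← Complex.ofReal_tsum, ← Complex.ofReal_exp] at h
  rw [← h, Complex.ofReal_re, log_exp]

lemma tendsto_tsum_neg_log_mul_rpow_sub_log_riemannZeta :
    Tendsto (fun s : ℝ ↦ ∑' p : Nat.Primes, -log (1 - 1 / (p : ℝ)) * (p : ℝ) ^ (-s) -
      log (riemannZeta ((1 + s : ℝ) : ℂ)).re) (𝓝[>] 0) (𝓝 0) := by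
  have hpow {p : Nat.Primes} {s : ℝ} (hs : 0 < s) : (p : ℝ) ^ (-s) ≤ 1 :=
    rpow_le_one_of_one_le_of_nonpos (by exact_mod_cast p.2.one_lt.le) (by linarith)
  have hmul (p : Nat.Primes) (s : ℝ) : (p : ℝ) ^ (-(1 + s)) = 1 / p * (p : ℝ) ^ (-s) := by
    have hp : (0 : ℝ) < p := by exact_mod_cast p.2.pos
    rw [neg_add, rpow_add hp, rpow_neg_one, one_div]
  have hbound {s : ℝ} (hs : 0 < s) (p : Nat.Primes) :
      ‖-log (1 - 1 / (p : ℝ)) * (p : ℝ) ^ (-s) - -log (1 - (p : ℝ) ^ (-(1 + s)))‖ ≤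
        2 * (p : ℝ) ^ (-2 : ℝ) := by
    have hp : (0 : ℝ) < p := by exact_mod_cast p.2.pos
    have hx := inv_prime_le_half p.2
    have h2 : (p : ℝ) ^ (-2 : ℝ) = (1 / p) ^ 2 := by
      rw [rpow_neg hp.le]; norm_num
    rw [hmul, h2]
    have ht0 : 0 < (p : ℝ) ^ (-s) := by positivity
    have ht1 := hpow (p := p) hs
    set x : ℝ := 1 / p
    set t : ℝ := (p : ℝ) ^ (-s)
    have hx0 : 0 ≤ x := by positivity
    have hxt : x * t ≤ x := mul_le_of_le_one_right hx0 ht1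
    have a1 := mul_le_mul_of_nonneg_right (le_neg_log_one_sub (x := x) (by linarith)) ht0.le
    have a2 := mul_le_mul_of_nonneg_right (neg_log_one_sub_le hx) ht0.le
    have a3 := le_neg_log_one_sub (x := x * t) (by linarith)
    have a4 := neg_log_one_sub_le (x := x * t) (by linarith)
    have a5 : x ^ 2 * t ≤ x ^ 2 := mul_le_of_le_one_right (sq_nonneg x) ht1
    have a6 : (x * t) ^ 2 ≤ x ^ 2 := pow_le_pow_left₀ (by positivity) hxt 2
    rw [norm_eq_abs, abs_le]
    constructor <;> linarith
  have hsum := (Nat.Primes.summable_rpow.2 (by norm_num : (-2 : ℝ) < -1)).mul_left 2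
  have hlim : Tendsto (fun s : ℝ ↦ ∑' p : Nat.Primes,
      (-log (1 - 1 / (p : ℝ)) * (p : ℝ) ^ (-s) - -log (1 - (p : ℝ) ^ (-(1 + s)))))
      (𝓝[>] 0) (𝓝 (∑' _ : Nat.Primes, 0)) := by
    refine tendsto_tsum_of_dominated_convergence hsum (fun p ↦ ?_) ?_
    · have hp : (0 : ℝ) < p := by exact_mod_cast p.2.pos
      have ht : Tendsto (fun s : ℝ ↦ (p : ℝ) ^ (-s)) (𝓝[>] 0) (𝓝 1) := by
        have := ((continuous_const_rpow hp.ne').comp continuous_neg).tendsto (0 : ℝ)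
        simp only [Function.comp_def, neg_zero, rpow_zero] at this
        exact this.mono_left nhdsWithin_le_nhds
      have hne : 1 - 1 / (p : ℝ) * 1 ≠ 0 := by
        linarith [inv_prime_le_half p.2]
      have hcont : ContinuousAt (fun t : ℝ ↦ -log (1 - 1 / (p : ℝ)) * t -
          -log (1 - 1 / (p : ℝ) * t)) 1 := by
        fun_prop (disch := exact hne)
      have := hcont.tendsto.comp ht
      simpa only [Function.comp_def, mul_one, sub_self, hmul] using this
    · filter_upwards [self_mem_nhdsWithin] with s hs p using hbound hs p
  rw [tsum_zero] at hlim
  refine hlim.congr' ?_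
  filter_upwards [self_mem_nhdsWithin] with s hs
  have hs : 0 < s := hs
  have h1 := summable_neg_log_mul_rpow hs
  have h2 : Summable fun p : Nat.Primes ↦ -log (1 - (p : ℝ) ^ (-(1 + s))) := by
    refine (h1.sub (hsum.of_norm_bounded (hbound hs))).congr fun p ↦ ?_
    ring
  rw [h1.tsum_sub h2, log_riemannZeta_re_eq_tsum hs]

/-- Mertens' third theorem. -/
theorem tendsto_prod_one_sub_inv_mul_log :
    Tendsto (fun n : ℕ ↦ (∏ p ∈ Nat.primesLE n, (1 - 1 / (p : ℝ))) * log n) atTop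
      (𝓝 (exp (-eulerMascheroniConstant))) := by
  obtain ⟨C, hC⟩ := exists_tendsto_sum_neg_log_sub_log_log
  have h1 := tendsto_tsum_neg_log_mul_rpow_add_log hC
  have h2 := tendsto_tsum_neg_log_mul_rpow_sub_log_riemannZeta
  have hshift : Tendsto (fun s : ℝ ↦ 1 + s) (𝓝[>] 0) (𝓝[>] 1) := by
    refine tendsto_nhdsWithin_iff.2 ⟨?_, ?_⟩
    · have : Tendsto (fun s : ℝ ↦ 1 + s) (𝓝 0) (𝓝 (1 + 0)) := by
        exact (continuous_const.add continuous_id).tendsto 0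
      rw [add_zero] at this
      exact this.mono_left nhdsWithin_le_nhds
    · filter_upwards [self_mem_nhdsWithin] with s hs
      simpa using hs
  have h3 := (Asymptotics.isLittleO_one_iff ℝ).1
    (log_riemannZeta_add_log_sub_isLittleO_ofReal.comp_tendsto hshift)
  have hCγ : C - eulerMascheroniConstant = 0 := by
    refine tendsto_nhds_unique (h1.congr fun s ↦ ?_) (by simpa using h2.add h3)
    simp
    ring
  rw [sub_eq_zero] at hCγ
  subst hCγ
  refine ((continuous_exp.tendsto _).comp hC.neg).congr' ?_
  filter_upwards [eventually_ge_atTop 2] with n hn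
  have hlog : 0 < log n := log_pos (by exact_mod_cast hn)
  have hfac (p : ℕ) (hp : p ∈ Nat.primesLE n) : 0 < 1 - 1 / (p : ℝ) := by
    linarith [inv_prime_le_half (Nat.prime_of_mem_primesLE hp)]
  simp only [Function.comp_apply]
  rw [neg_sub, exp_sub, exp_log hlog, Finset.sum_neg_distrib, exp_neg,
    ← log_prod fun p hp ↦ (hfac p hp).ne', exp_log (Finset.prod_pos hfac)]
  field_simp

lemma abs_euler_factor_sub_one_le {p : ℕ} (hp : p.Prime) {x : ℝ} (h1 : 1 - 1 / ((p : ℝ) - 1) ≤ x)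
    (h2 : x ≤ 1 - 1 / p + 1 / (p * ((p : ℝ) - 1))) :
    |(1 - 1 / (p : ℝ))⁻¹ * x - 1| ≤ 1 / ((p : ℝ) - 1) ^ 2 := by
  have hp2 : (2 : ℝ) ≤ p := by exact_mod_cast hp.two_le
  have hp0 : (0 : ℝ) < p := by linarith
  have hp1 : (0 : ℝ) < p - 1 := by linarith
  have hinv : (1 - 1 / (p : ℝ))⁻¹ = p / (p - 1) := by
    rw [one_sub_div hp0.ne', inv_div]
  have hq : 0 ≤ (p : ℝ) / (p - 1) := by positivity
  have a1 := mul_le_mul_of_nonneg_left h1 hq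
  have a2 := mul_le_mul_of_nonneg_left h2 hq
  have e1 : (p : ℝ) / (p - 1) * (1 - 1 / ((p : ℝ) - 1)) = 1 - 1 / ((p : ℝ) - 1) ^ 2 := by
    field_simp; ring
  have e2 : (p : ℝ) / (p - 1) * (1 - 1 / p + 1 / (p * ((p : ℝ) - 1))) =
      1 + 1 / ((p : ℝ) - 1) ^ 2 := by
    field_simp
  rw [hinv, abs_le]
  constructor <;> linarith

lemma summable_one_div_sub_one_sq : Summable fun n : ℕ ↦ 1 / ((n : ℝ) - 1) ^ 2 := by
  rw [← summable_nat_add_iff 1]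
  simp

lemma tendsto_prod_primesLE {G : ℕ → ℝ} (hG : Multipliable fun p : Nat.Primes ↦ G p) :
    Tendsto (fun n ↦ ∏ p ∈ Nat.primesLE n, G p) atTop (𝓝 (∏' p : Nat.Primes, G p)) := by
  have hmono : Monotone fun n ↦ Finset.subtype Nat.Prime (Nat.primesLE n) :=
    fun m n hmn p hp ↦ Finset.mem_subtype.2 (Nat.primesLE_mono hmn (Finset.mem_subtype.1 hp))
  have hT := tendsto_atTop_finset_of_monotone hmono fun p ↦
    ⟨p, Finset.mem_subtype.2 (Nat.mem_primesLE.2 ⟨le_rfl, p.2⟩)⟩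
  refine (hG.hasProd.comp hT).congr fun n ↦ ?_
  exact Finset.prod_subtype_of_mem G fun p hp ↦ Nat.prime_of_mem_primesLE hp

lemma multipliable_of_abs_sub_one_le {ι : Type*} {g : ι → ℕ} (hg : Function.Injective g)
    {f : ι → ℝ} (hf : ∀ i, |f i - 1| ≤ 1 / ((g i : ℝ) - 1) ^ 2) : Multipliable f := by
  refine (multipliable_one_add_of_summable (f := fun i ↦ f i - 1) ?_).congr fun i ↦ by ring
  exact Summable.of_nonneg_of_le (fun i ↦ norm_nonneg _) hf
    (summable_one_div_sub_one_sq.comp_injective hg)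

lemma card_mul_log_le_of_subset_primeFactors {n : ℕ} (hn : 1 ≤ n) {s : Finset ℕ}
    (hs : s ⊆ n.primeFactors) {y : ℝ} (hy : 0 < y) (h : ∀ p ∈ s, y ≤ p) :
    s.card * log y ≤ log n := by
  rw [← log_pow]
  refine log_le_log (by positivity) ?_
  calc y ^ s.card = ∏ _p ∈ s, y := by simp
    _ ≤ ∏ p ∈ s, (p : ℝ) := Finset.prod_le_prod (fun _ _ ↦ hy.le) h
    _ ≤ n := by
      rw [← Nat.cast_prod]
      exact_mod_cast Nat.le_of_dvd hn
        ((Finset.prod_dvd_prod_of_subset _ _ _ hs).trans (Nat.prod_primeFactors_dvd n))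

/-- Primes exceeding `log n` contribute a factor tending to `1`. -/
lemma prod_primesLE_mul_le_prod_primeFactors {m : ℕ → ℝ} (hm0 : ∀ p : ℕ, p.Prime → 0 ≤ m p)
    (hm1 : ∀ p : ℕ, p.Prime → m p ≤ 1) (hm : ∀ p : ℕ, p.Prime → 1 - 1 / ((p : ℝ) - 1) ≤ m p)
    {n : ℕ} (hn : 2 ≤ log n) :
    (∏ p ∈ Nat.primesLE ⌊log n⌋₊, m p) * (1 - 2 / log (log n)) ≤
      ∏ p ∈ n.primeFactors, m p := by
  have hn1 : 1 ≤ n := by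
    rcases Nat.eq_zero_or_pos n with rfl | h
    · norm_num at hn
    · exact h
  set x := log n with hx
  have hlx : 0 < log x := log_pos (by linarith)
  set t : ℝ := 1 / (x - 1) with ht
  have ht1 : t ≤ 1 := by
    rw [ht, div_le_one (by linarith)]
    linarith
  have ht0 : 0 ≤ t := by
    have : 0 < x - 1 := by linarith
    positivity
  set s₁ := n.primeFactors.filter (· ≤ ⌊x⌋₊)
  set s₂ := n.primeFactors.filter (¬ · ≤ ⌊x⌋₊) with hs₂
  have hsub : s₁ ⊆ Nat.primesLE ⌊x⌋₊ := fun p hp ↦ by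
    have := Finset.mem_filter.1 hp
    exact Nat.mem_primesLE.2 ⟨this.2, Nat.prime_of_mem_primeFactors this.1⟩
  have h1 : ∏ p ∈ Nat.primesLE ⌊x⌋₊, m p ≤ ∏ p ∈ s₁, m p := by
    rw [← Finset.prod_sdiff hsub]
    refine mul_le_of_le_one_left
      (Finset.prod_nonneg fun p hp ↦ hm0 p (Nat.prime_of_mem_primesLE (hsub hp)))
      (Finset.prod_le_one (fun p hp ↦ ?_) fun p hp ↦ ?_)
    · exact hm0 p (Nat.prime_of_mem_primesLE (Finset.sdiff_subset hp))
    · exact hm1 p (Nat.prime_of_mem_primesLE (Finset.sdiff_subset hp))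
  have hlt (p : ℕ) (hp : p ∈ s₂) : x < p := by
    have := (Finset.mem_filter.1 hp).2
    exact Nat.lt_of_floor_lt (not_le.1 this)
  have hcard : s₂.card * log x ≤ x :=
    card_mul_log_le_of_subset_primeFactors hn1 (Finset.filter_subset _ _) (by linarith)
      fun p hp ↦ (hlt p hp).le
  have hkt : s₂.card * t ≤ 2 / log x := by
    have hk : (s₂.card : ℝ) ≤ x / log x := by rwa [le_div_iff₀ hlx]
    calc s₂.card * t ≤ x / log x * t := by gcongr
      _ = (x / (x - 1)) / log x := by rw [ht]; field_simp
      _ ≤ 2 / log x := by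
        gcongr
        rw [div_le_iff₀ (by linarith)]
        linarith
  have h2 : 1 - 2 / log x ≤ ∏ p ∈ s₂, m p := by
    calc 1 - 2 / log x ≤ 1 + s₂.card * (-t) := by linarith
      _ ≤ (1 + -t) ^ s₂.card := one_add_mul_le_pow (by linarith) _
      _ = ∏ _p ∈ s₂, (1 + -t) := by simp
      _ ≤ ∏ p ∈ s₂, m p := by
        refine Finset.prod_le_prod (fun _ _ ↦ by linarith) fun p hp ↦ ?_
        refine le_trans ?_ (hm p (Nat.prime_of_mem_primeFactors (Finset.mem_filter.1 hp).1))
        have : 1 / ((p : ℝ) - 1) ≤ t :=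
          one_div_le_one_div_of_le (by linarith) (by linarith [hlt p hp])
        linarith
  rw [← Finset.prod_filter_mul_prod_filter_not n.primeFactors (· ≤ ⌊x⌋₊)]
  have h0 : 0 ≤ ∏ p ∈ Nat.primesLE ⌊x⌋₊, m p :=
    Finset.prod_nonneg fun p hp ↦ hm0 p (Nat.prime_of_mem_primesLE hp)
  calc _ ≤ (∏ p ∈ Nat.primesLE ⌊x⌋₊, m p) * ∏ p ∈ s₂, m p := mul_le_mul_of_nonneg_left h2 h0
    _ ≤ _ := mul_le_mul_of_nonneg_right h1
      (Finset.prod_nonneg fun p hp ↦ hm0 p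
        (Nat.prime_of_mem_primeFactors (Finset.mem_filter.1 hp).1))

lemma prod_primesLE_eq (m : ℕ → ℝ) (n : ℕ) :
    ∏ p ∈ Nat.primesLE n, m p = (∏ p ∈ Nat.primesLE n, (1 - 1 / (p : ℝ))) *
      ∏ p ∈ Nat.primesLE n, (1 - 1 / (p : ℝ))⁻¹ * m p := by
  rw [← Finset.prod_mul_distrib]
  refine Finset.prod_congr rfl fun p hp ↦ ?_
  have := inv_prime_le_half (Nat.prime_of_mem_primesLE hp)
  rw [mul_inv_cancel_left₀ (by linarith)]

/-- A minorant, converging to the expected limit, of `f n * log (log n)` whenever `f` dominates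
the product of the local infima `m p`. -/
lemma exists_tendsto_le_mul_log_log {f : ℕ → ℝ} {m : ℕ → ℝ} (hm0 : ∀ p : ℕ, p.Prime → 0 ≤ m p)
    (hm1 : ∀ p : ℕ, p.Prime → m p ≤ 1) (hm : ∀ p : ℕ, p.Prime → 1 - 1 / ((p : ℝ) - 1) ≤ m p)
    (hG : Multipliable fun p : Nat.Primes ↦ (1 - 1 / (p : ℝ))⁻¹ * m p)
    (hf : ∀ n, 1 ≤ n → ∏ p ∈ n.primeFactors, m p ≤ f n) :
    ∃ l : ℕ → ℝ, Tendsto l atTop (𝓝 (exp (-eulerMascheroniConstant) *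
      ∏' p : Nat.Primes, (1 - 1 / (p : ℝ))⁻¹ * m p)) ∧
      ∀ᶠ n : ℕ in atTop, l n ≤ f n * log (log n) := by
  have hlog : Tendsto (fun n : ℕ ↦ log n) atTop atTop :=
    tendsto_log_atTop.comp tendsto_natCast_atTop_atTop
  have hfl : Tendsto (fun n : ℕ ↦ ⌊log n⌋₊) atTop atTop := tendsto_nat_floor_atTop.comp hlog
  have hll : Tendsto (fun n : ℕ ↦ log (log n)) atTop atTop := tendsto_log_atTop.comp hlog
  have h1 := (tendsto_prod_one_sub_inv_mul_log.comp hfl).mul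
    ((tendsto_prod_primesLE (G := fun p ↦ (1 - 1 / (p : ℝ))⁻¹ * m p) hG).comp hfl)
  have h2 : Tendsto (fun n : ℕ ↦ 1 - 2 / log (log n)) atTop (𝓝 (1 - 0)) :=
    tendsto_const_nhds.sub (Tendsto.const_div_atTop hll _)
  have h3 := (h1.mul h2)
  rw [sub_zero, mul_one] at h3
  refine ⟨fun n ↦ (∏ p ∈ Nat.primesLE ⌊log n⌋₊, (1 - 1 / (p : ℝ))) * log ⌊log n⌋₊ *
    (∏ p ∈ Nat.primesLE ⌊log n⌋₊, (1 - 1 / (p : ℝ))⁻¹ * m p) * (1 - 2 / log (log n)), h3, ?_⟩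
  filter_upwards [hlog.eventually_ge_atTop 2, hll.eventually_ge_atTop 2,
    eventually_ge_atTop 1] with n hn hn2 hn1
  have hfloor1 : 1 ≤ ⌊log n⌋₊ := Nat.le_floor (by norm_num; linarith)
  have hfloor : log ⌊log n⌋₊ ≤ log (log n) :=
    log_le_log (by exact_mod_cast hfloor1) (Nat.floor_le (by linarith))
  have h0 : 0 ≤ ∏ p ∈ Nat.primesLE ⌊log n⌋₊, m p :=
    Finset.prod_nonneg fun p hp ↦ hm0 p (Nat.prime_of_mem_primesLE hp)
  have h3 : 0 ≤ 1 - 2 / log (log n) := by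
    rw [sub_nonneg, div_le_one (by linarith)]
    exact hn2
  calc _ = (∏ p ∈ Nat.primesLE ⌊log n⌋₊, m p) * (1 - 2 / log (log n)) * log ⌊log n⌋₊ := by
        rw [prod_primesLE_eq m]; ring
    _ ≤ (∏ p ∈ Nat.primesLE ⌊log n⌋₊, m p) * (1 - 2 / log (log n)) * log (log n) :=
        mul_le_mul_of_nonneg_left hfloor (mul_nonneg h0 h3)
    _ ≤ f n * log (log n) := mul_le_mul_of_nonneg_right
        ((prod_primesLE_mul_le_prod_primeFactors hm0 hm1 hm hn).trans (hf n hn1)) (by linarith)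

lemma one_sub_le_map_prime_pow_div {A : ℕ → Finset ℕ} {φ : ℕ → ℝ}
    (hdvd : ∀ n : ℕ, 1 ≤ n → ∀ d ∈ A n, d ∣ n) (hself : ∀ n : ℕ, 1 ≤ n → n ∈ A n)
    (hsum : ∀ n : ℕ, 1 ≤ n → ∑ d ∈ A n, φ d = n) (hbd : ∀ n : ℕ, 1 ≤ n → 1 ≤ φ n ∧ φ n ≤ n)
    {p : ℕ} (hp : p.Prime) (k : ℕ) :
    1 - 1 / ((p : ℝ) - 1) ≤ φ (p ^ k) / (p : ℝ) ^ k := by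
  have hp2 : (2 : ℝ) ≤ p := by exact_mod_cast hp.two_le
  have hpk : 1 ≤ p ^ k := Nat.one_le_pow _ _ hp.pos
  have hpk0 : (0 : ℝ) < (p : ℝ) ^ k := by positivity
  have h1 : ∑ d ∈ (A (p ^ k)).erase (p ^ k), φ d ≤ ∑ j ∈ Finset.range k, (p : ℝ) ^ j := by
    have hsub : (A (p ^ k)).erase (p ^ k) ⊆ (p ^ k).properDivisors := fun d hd ↦ by
      obtain ⟨hne, hd⟩ := Finset.mem_erase.1 hd
      have := hdvd _ hpk d hd
      exact Nat.mem_properDivisors.2 ⟨this, lt_of_le_of_ne (Nat.le_of_dvd hpk this) hne⟩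
    calc ∑ d ∈ (A (p ^ k)).erase (p ^ k), φ d
        ≤ ∑ d ∈ (A (p ^ k)).erase (p ^ k), (d : ℝ) := Finset.sum_le_sum fun d hd ↦
          (hbd d (Nat.pos_of_mem_properDivisors (hsub hd))).2
      _ ≤ ∑ d ∈ (p ^ k).properDivisors, (d : ℝ) :=
          Finset.sum_le_sum_of_subset_of_nonneg hsub fun _ _ _ ↦ Nat.cast_nonneg _
      _ = ∑ j ∈ Finset.range k, (p : ℝ) ^ j := by
          simp [Nat.properDivisors_prime_pow hp]
  have h2 := hsum _ hpk
  rw [← Finset.add_sum_erase _ _ (hself _ hpk)] at h2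
  push_cast at h2
  have h3 : (∑ j ∈ Finset.range k, (p : ℝ) ^ j) * (p - 1) = (p : ℝ) ^ k - 1 := geom_sum_mul _ _
  have h4 : ∑ j ∈ Finset.range k, (p : ℝ) ^ j ≤ (p : ℝ) ^ k / (p - 1) := by
    rw [le_div_iff₀ (by linarith)]
    linarith
  rw [le_div_iff₀ hpk0, sub_mul, one_mul, one_div_mul_eq_div]
  linarith

lemma map_prime_pow_div_le {A : ℕ → Finset ℕ} {φ : ℕ → ℝ}
    (hdvd : ∀ n : ℕ, 1 ≤ n → ∀ d ∈ A n, d ∣ n) (hself : ∀ n : ℕ, 1 ≤ n → n ∈ A n)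
    (hsum : ∀ n : ℕ, 1 ≤ n → ∑ d ∈ A n, φ d = n) (hbd : ∀ n : ℕ, 1 ≤ n → 1 ≤ φ n ∧ φ n ≤ n)
    {p : ℕ} (hp : p.Prime) {k : ℕ} (hk : p ^ k ∈ A (p ^ (k + 1))) :
    φ (p ^ (k + 1)) / (p : ℝ) ^ (k + 1) ≤ 1 - 1 / p + 1 / (p * ((p : ℝ) - 1)) := by
  have hp2 : (2 : ℝ) ≤ p := by exact_mod_cast hp.two_le
  have hpk : 1 ≤ p ^ (k + 1) := Nat.one_le_pow _ _ hp.pos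
  have hpk0 : (0 : ℝ) < (p : ℝ) ^ k := by positivity
  have h1 := one_sub_le_map_prime_pow_div hdvd hself hsum hbd hp k
  rw [le_div_iff₀ hpk0] at h1
  have hne : p ^ k ≠ p ^ (k + 1) := (Nat.pow_lt_pow_right hp.one_lt k.lt_succ_self).ne
  have h2 : φ (p ^ k) + φ (p ^ (k + 1)) ≤ ∑ d ∈ A (p ^ (k + 1)), φ d := by
    rw [← Finset.sum_pair hne]
    refine Finset.sum_le_sum_of_subset_of_nonneg ?_ fun d hd _ ↦ ?_
    · simp [Finset.insert_subset_iff, hk, hself _ hpk]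
    · linarith [(hbd d (Nat.pos_of_dvd_of_pos (hdvd _ hpk d hd) hpk)).1]
  rw [hsum _ hpk] at h2
  push_cast at h2
  rw [div_le_iff₀ (by positivity)]
  have h3 : (1 - 1 / (p : ℝ) + 1 / (p * ((p : ℝ) - 1))) * p ^ (k + 1) =
      p ^ (k + 1) - (1 - 1 / ((p : ℝ) - 1)) * p ^ k := by
    have : (p : ℝ) - 1 ≠ 0 := by linarith
    rw [pow_succ]
    field_simp
    ring
  linarith

lemma map_prod_prime_pow {φ : ℕ → ℝ} (h1 : φ 1 = 1)
    (hm : ∀ m n : ℕ, 1 ≤ m → 1 ≤ n → Nat.Coprime m n → φ (m * n) = φ m * φ n)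
    (a : ℕ → ℕ) (s : Finset ℕ) (hs : ∀ p ∈ s, p.Prime) :
    φ (∏ p ∈ s, p ^ a p) = ∏ p ∈ s, φ (p ^ a p) := by
  induction s using Finset.induction_on with
  | empty => simpa
  | insert q s hq ih =>
    have hs' : ∀ p ∈ s, p.Prime := fun p hp ↦ hs p (Finset.mem_insert_of_mem hp)
    have hqp := hs q (Finset.mem_insert_self q s)
    rw [Finset.prod_insert hq, Finset.prod_insert hq, hm, ih hs']
    · exact Nat.one_le_pow _ _ hqp.pos
    · exact Finset.prod_pos fun p hp ↦ pow_pos (hs' p hp).pos _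
    · exact Nat.Coprime.prod_right fun p hp ↦
        Nat.coprime_pow_primes _ _ hqp (hs' p hp) fun h ↦ hq (h ▸ hp)

lemma map_prod_prime_pow_div {φ : ℕ → ℝ} (h1 : φ 1 = 1)
    (hm : ∀ m n : ℕ, 1 ≤ m → 1 ≤ n → Nat.Coprime m n → φ (m * n) = φ m * φ n)
    (a : ℕ → ℕ) (s : Finset ℕ) (hs : ∀ p ∈ s, p.Prime) :
    φ (∏ p ∈ s, p ^ a p) / (∏ p ∈ s, p ^ a p : ℕ) = ∏ p ∈ s, φ (p ^ a p) / (p : ℝ) ^ a p := by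
  rw [map_prod_prime_pow h1 hm a s hs, Finset.prod_div_distrib]
  push_cast
  rfl

lemma map_div_eq_prod_primeFactors {φ : ℕ → ℝ} (h1 : φ 1 = 1)
    (hm : ∀ m n : ℕ, 1 ≤ m → 1 ≤ n → Nat.Coprime m n → φ (m * n) = φ m * φ n)
    {n : ℕ} (hn : 1 ≤ n) :
    φ n / n = ∏ p ∈ n.primeFactors, φ (p ^ n.factorization p) / (p : ℝ) ^ n.factorization p := by
  rw [← map_prod_prime_pow_div h1 hm _ _ fun p ↦ Nat.prime_of_mem_primeFactors,
    ← Nat.prod_factorization_eq_prod_primeFactors, Nat.prod_factorization_pow_eq_self (by omega)]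

lemma log_prod_prime_pow_le {a : ℕ → ℕ} {C δ : ℝ} (hδ : 0 < δ)
    (ha : ∀ p : ℕ, p.Prime → (a p : ℝ) ≤ C * (p : ℝ) ^ δ) (hC : 0 ≤ C) (y : ℕ) :
    log (∏ p ∈ Nat.primesLE y, p ^ a p : ℕ) ≤ C * log 4 * (y : ℝ) ^ (1 + δ) := by
  rcases Nat.eq_zero_or_pos y with rfl | hy
  · have : Nat.primesLE 0 = ∅ := by decide
    rw [this]
    simp only [Finset.prod_empty, Nat.cast_one, log_one]
    positivity
  have hy0 : (0 : ℝ) < y := by exact_mod_cast hy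
  push_cast
  rw [log_prod fun p hp ↦ by
    have := (Nat.prime_of_mem_primesLE hp).pos
    positivity]
  calc ∑ p ∈ Nat.primesLE y, log ((p : ℝ) ^ a p)
      ≤ ∑ p ∈ Nat.primesLE y, C * (y : ℝ) ^ δ * log p := Finset.sum_le_sum fun p hp ↦ by
        obtain ⟨hpy, hp⟩ := Nat.mem_primesLE.1 hp
        have h1 : (1 : ℝ) ≤ p := by exact_mod_cast hp.one_le
        rw [log_pow]
        refine mul_le_mul_of_nonneg_right ((ha p hp).trans ?_) (log_nonneg h1)
        gcongr
    _ = C * (y : ℝ) ^ δ * Chebyshev.theta y := by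
        rw [← Finset.mul_sum, Chebyshev.theta_eq_sum_primesLE_log]
    _ ≤ C * (y : ℝ) ^ δ * (log 4 * y) := by
        gcongr
        exact Chebyshev.theta_le_log4_mul_x hy0.le
    _ = C * log 4 * (y : ℝ) ^ (1 + δ) := by
        rw [rpow_add hy0, rpow_one]
        ring

lemma eventually_log_log_prod_prime_pow_le {a : ℕ → ℕ} {C δ : ℝ} (hδ : 0 < δ)
    (ha : ∀ p : ℕ, p.Prime → (a p : ℝ) ≤ C * (p : ℝ) ^ δ) (hC : 0 < C) :
    ∀ᶠ y : ℕ in atTop, log (log (∏ p ∈ Nat.primesLE y, p ^ a p : ℕ)) ≤ (1 + 2 * δ) * log y := by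
  have hlog : Tendsto (fun y : ℕ ↦ δ * log y) atTop atTop :=
    (tendsto_log_atTop.comp tendsto_natCast_atTop_atTop).const_mul_atTop hδ
  filter_upwards [hlog.eventually_ge_atTop (log (C * log 4)), eventually_ge_atTop 1] with y hy hy1
  have hy0 : (0 : ℝ) < y := by exact_mod_cast hy1
  have hly : 0 ≤ log (y : ℝ) := log_natCast_nonneg y
  have h4 : 0 < log (4 : ℝ) := log_pos (by norm_num)
  rcases (log_natCast_nonneg (∏ p ∈ Nat.primesLE y, p ^ a p)).eq_or_lt with h | h
  · rw [← h, log_zero]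
    positivity
  · calc _ ≤ log (C * log 4 * (y : ℝ) ^ (1 + δ)) :=
          log_le_log h (log_prod_prime_pow_le hδ ha hC.le y)
      _ = log (C * log 4) + (1 + δ) * log y := by
          rw [log_mul (by positivity) (by positivity), log_rpow hy0]
      _ ≤ _ := by linarith

lemma frequently_map_div_mul_log_log_le {φ : ℕ → ℝ} (h1 : φ 1 = 1)
    (hm : ∀ m n : ℕ, 1 ≤ m → 1 ≤ n → Nat.Coprime m n → φ (m * n) = φ m * φ n)
    (hφ : ∀ n : ℕ, 1 ≤ n → 0 ≤ φ n) {a : ℕ → ℕ} {C δ : ℝ} (hδ : 0 < δ) (hC : 0 < C)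
    (ha : ∀ p : ℕ, p.Prime → (a p : ℝ) ≤ C * (p : ℝ) ^ δ)
    (ha1 : ∀ᶠ p : ℕ in atTop, p.Prime → 1 ≤ a p) {Q : ℝ}
    (hQ : ∀ᶠ y : ℕ in atTop,
      ∏ p ∈ Nat.primesLE y, (1 - 1 / (p : ℝ))⁻¹ * (φ (p ^ a p) / (p : ℝ) ^ a p) ≤ Q)
    {c : ℝ} (hc : exp (-eulerMascheroniConstant) * (Q * (1 + 2 * δ)) < c) :
    ∃ᶠ n : ℕ in atTop, φ n / n * log (log n) ≤ c := by
  have hlim := (tendsto_prod_one_sub_inv_mul_log.mul_const (Q * (1 + 2 * δ))).eventually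
    (eventually_le_nhds hc)
  obtain ⟨y₀, hy₀⟩ := eventually_atTop.1
    (((hlim.and hQ).and (eventually_log_log_prod_prime_pow_le hδ ha hC)).and ha1)
  refine frequently_atTop.2 fun B ↦ ?_
  obtain ⟨q, hqB, hq⟩ := Nat.exists_infinite_primes (max B y₀)
  obtain ⟨⟨⟨hlim, hQ⟩, hN⟩, ha1⟩ := hy₀ q ((le_max_right _ _).trans hqB)
  set N := ∏ p ∈ Nat.primesLE q, p ^ a p with hNdef
  have hprime (p : ℕ) (hp : p ∈ Nat.primesLE q) : p.Prime := Nat.prime_of_mem_primesLE hp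
  have hNpos : 1 ≤ N := Finset.prod_pos fun p hp ↦ pow_pos (hprime p hp).pos _
  refine ⟨N, ?_, ?_⟩
  · have h2 : q ^ a q ∣ N :=
      Finset.dvd_prod_of_mem (fun p ↦ p ^ a p) (Nat.mem_primesLE.2 ⟨le_rfl, hq⟩)
    calc B ≤ q := (le_max_left _ _).trans hqB
      _ = q ^ 1 := (pow_one q).symm
      _ ≤ q ^ a q := Nat.pow_le_pow_right hq.pos (ha1 hq)
      _ ≤ N := Nat.le_of_dvd hNpos h2
  · have hlq : 0 ≤ log (q : ℝ) := log_natCast_nonneg q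
    have hM : 0 ≤ ∏ p ∈ Nat.primesLE q, (1 - 1 / (p : ℝ)) := Finset.prod_nonneg fun p hp ↦ by
      linarith [inv_prime_le_half (hprime p hp)]
    calc φ N / N * log (log N) ≤ φ N / N * ((1 + 2 * δ) * log q) :=
          mul_le_mul_of_nonneg_left hN (div_nonneg (hφ N hNpos) (Nat.cast_nonneg _))
      _ = (∏ p ∈ Nat.primesLE q, (1 - 1 / (p : ℝ))) *
            (∏ p ∈ Nat.primesLE q, (1 - 1 / (p : ℝ))⁻¹ * (φ (p ^ a p) / (p : ℝ) ^ a p)) *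
            ((1 + 2 * δ) * log q) := by
          rw [hNdef, map_prod_prime_pow_div h1 hm a _ hprime,
            prod_primesLE_eq fun p ↦ φ (p ^ a p) / (p : ℝ) ^ a p]
      _ ≤ (∏ p ∈ Nat.primesLE q, (1 - 1 / (p : ℝ))) * Q * ((1 + 2 * δ) * log q) := by
          gcongr
      _ = (∏ p ∈ Nat.primesLE q, (1 - 1 / (p : ℝ))) * log q * (Q * (1 + 2 * δ)) := by ring
      _ ≤ c := hlim

lemma exists_le_mul_rpow_of_tendsto_log_div_log {e : ℕ → ℕ}
    (he : Tendsto (fun p : ℕ ↦ log (e p) / log p)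
      (atTop ⊓ 𝓟 {p : ℕ | p.Prime ∧ 2 < p}) (𝓝 0)) {δ : ℝ} (hδ : 0 < δ) :
    ∃ C : ℝ, 0 < C ∧ ∀ p : ℕ, p.Prime → 2 < p → (e p : ℝ) ≤ C * (p : ℝ) ^ δ := by
  obtain ⟨P, hP⟩ := eventually_atTop.1
    (eventually_inf_principal.1 (he.eventually (eventually_le_nhds hδ)))
  refine ⟨1 + ∑ i ∈ Finset.range P, (e i : ℝ), by positivity, fun p hp hp2 ↦ ?_⟩
  have hp1 : (1 : ℝ) < p := by exact_mod_cast hp.one_lt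
  have hpδ : 1 ≤ (p : ℝ) ^ δ := one_le_rpow hp1.le hδ.le
  have hS : 0 ≤ ∑ i ∈ Finset.range P, (e i : ℝ) := by positivity
  rcases lt_or_ge p P with h | h
  · have : (e p : ℝ) ≤ ∑ i ∈ Finset.range P, (e i : ℝ) :=
      Finset.single_le_sum (f := fun i ↦ (e i : ℝ)) (fun _ _ ↦ Nat.cast_nonneg _)
        (Finset.mem_range.2 h)
    nlinarith
  · have h2 := hP p h ⟨hp, hp2⟩
    rw [div_le_iff₀ (log_pos hp1), ← log_rpow (by linarith)] at h2
    have h3 : (e p : ℝ) ≤ (p : ℝ) ^ δ := by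
      rcases Nat.eq_zero_or_pos (e p) with h0 | h0
      · rw [h0, Nat.cast_zero]
        positivity
      · exact (log_le_log_iff (by exact_mod_cast h0) (by positivity)).1 h2
    nlinarith

lemma prod_primesLE_le_mul_exp {h : ℕ → ℝ} (h0 : ∀ p : ℕ, p.Prime → 0 ≤ h p) {K : ℕ}
    (hK : ∀ p : ℕ, p.Prime → K < p → h p ≤ 1 + 1 / ((p : ℝ) - 1) ^ 2) {y : ℕ} (hy : K ≤ y) :
    ∏ p ∈ Nat.primesLE y, h p ≤ (∏ p ∈ Nat.primesLE K, h p) *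
      exp (∑' n : ℕ, 1 / ((n : ℝ) - 1) ^ 2 -
        ∑ n ∈ Finset.range (K + 1), 1 / ((n : ℝ) - 1) ^ 2) := by
  have hmem (p : ℕ) (hp : p ∈ Nat.primesLE y \ Nat.primesLE K) : p.Prime ∧ K < p := by
    obtain ⟨h1, h2⟩ := Finset.mem_sdiff.1 hp
    have hp := Nat.prime_of_mem_primesLE h1
    exact ⟨hp, not_le.1 fun h ↦ h2 (Nat.mem_primesLE.2 ⟨h, hp⟩)⟩
  have hdisj : Disjoint (Nat.primesLE y \ Nat.primesLE K) (Finset.range (K + 1)) :=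
    Finset.disjoint_left.2 fun p hp hp' ↦ by
      have := (hmem p hp).2
      have := Finset.mem_range.1 hp'
      omega
  have hsum := summable_one_div_sub_one_sq.sum_le_tsum
    ((Nat.primesLE y \ Nat.primesLE K) ∪ Finset.range (K + 1)) fun n _ ↦ by positivity
  rw [Finset.sum_union hdisj] at hsum
  rw [← Finset.prod_sdiff (Nat.primesLE_mono hy), mul_comm]
  refine mul_le_mul_of_nonneg_left ?_
    (Finset.prod_nonneg fun p hp ↦ h0 p (Nat.prime_of_mem_primesLE hp))
  calc ∏ p ∈ Nat.primesLE y \ Nat.primesLE K, h p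
      ≤ ∏ p ∈ Nat.primesLE y \ Nat.primesLE K, exp (1 / ((p : ℝ) - 1) ^ 2) :=
        Finset.prod_le_prod (fun p hp ↦ h0 p (hmem p hp).1) fun p hp ↦
          (hK p (hmem p hp).1 (hmem p hp).2).trans (by
            linarith [add_one_le_exp (1 / ((p : ℝ) - 1) ^ 2)])
    _ = exp (∑ p ∈ Nat.primesLE y \ Nat.primesLE K, 1 / ((p : ℝ) - 1) ^ 2) := (exp_sum _ _).symm
    _ ≤ _ := exp_le_exp.2 (by linarith)

/-- Finitely many near-optimal exponents suffice to approximate the product of local infima. -/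
lemma exists_prod_primesLE_mul_exp_lt {r : ℕ → ℕ → ℝ} (hr : ∀ p k, 0 ≤ r p k)
    (hG : Multipliable fun p : Nat.Primes ↦ (1 - 1 / (p : ℝ))⁻¹ * ⨅ k, r p k) {g c : ℝ}
    (hc : g * ∏' p : Nat.Primes, (1 - 1 / (p : ℝ))⁻¹ * ⨅ k, r p k < c) :
    ∃ K ≥ 2, ∃ b : ℕ → ℕ, ∃ δ > 0,
      g * ((∏ p ∈ Nat.primesLE K, (1 - 1 / (p : ℝ))⁻¹ * r p (b p)) *
        exp (∑' n : ℕ, 1 / ((n : ℝ) - 1) ^ 2 -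
          ∑ n ∈ Finset.range (K + 1), 1 / ((n : ℝ) - 1) ^ 2) * (1 + 2 * δ)) < c := by
  have hT : Tendsto (fun K ↦ exp (∑' n : ℕ, 1 / ((n : ℝ) - 1) ^ 2 -
      ∑ n ∈ Finset.range (K + 1), 1 / ((n : ℝ) - 1) ^ 2)) atTop (𝓝 1) := by
    have := (summable_one_div_sub_one_sq.hasSum.tendsto_sum_nat.comp
      (tendsto_add_atTop_nat 1)).const_sub (∑' n : ℕ, 1 / ((n : ℝ) - 1) ^ 2)
    rw [sub_self] at this
    have h := (continuous_exp.tendsto 0).comp this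
    rwa [exp_zero] at h
  have hlim := ((tendsto_prod_primesLE (G := fun p ↦ (1 - 1 / (p : ℝ))⁻¹ * ⨅ k, r p k)
    hG).mul hT).const_mul g
  rw [mul_one] at hlim
  obtain ⟨K, hK, hK2⟩ := ((hlim.eventually (gt_mem_nhds hc)).and (eventually_ge_atTop 2)).exists
  have hu (p : ℕ) : ∃ u : ℕ → ℕ, Tendsto (fun j ↦ r p (u j)) atTop (𝓝 (⨅ k, r p k)) := by
    obtain ⟨v, -, hv, hmem⟩ := exists_seq_tendsto_sInf (S := Set.range (r p))
      (Set.range_nonempty _) ⟨0, by rintro _ ⟨k, rfl⟩; exact hr p k⟩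
    choose u hu using hmem
    exact ⟨u, by simp only [hu]; exact hv⟩
  choose u hu using hu
  have hδ : Tendsto (fun j : ℕ ↦ 1 + 2 * (1 / ((j : ℝ) + 1))) atTop (𝓝 (1 + 2 * 0)) :=
    (tendsto_one_div_add_atTop_nhds_zero_nat.const_mul 2).const_add 1
  have hlim2 := ((((tendsto_finsetProd (Nat.primesLE K) fun p _ ↦
    (hu p).const_mul ((1 - 1 / (p : ℝ))⁻¹)).mul_const
      (exp (∑' n : ℕ, 1 / ((n : ℝ) - 1) ^ 2 -
        ∑ n ∈ Finset.range (K + 1), 1 / ((n : ℝ) - 1) ^ 2))).mul hδ).const_mul g)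
  rw [mul_zero, add_zero, mul_one] at hlim2
  obtain ⟨j, hj⟩ := (hlim2.eventually (gt_mem_nhds hK)).exists
  exact ⟨K, hK2, fun p ↦ u p j, 1 / ((j : ℝ) + 1), by positivity, hj⟩

lemma frequently_map_div_mul_log_log_le_of_lt {φ : ℕ → ℝ} (h1 : φ 1 = 1)
    (hm : ∀ m n : ℕ, 1 ≤ m → 1 ≤ n → Nat.Coprime m n → φ (m * n) = φ m * φ n)
    (hr : ∀ p k : ℕ, 0 ≤ φ (p ^ k) / (p : ℝ) ^ k) (hφ : ∀ n : ℕ, 1 ≤ n → 0 ≤ φ n)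
    {e : ℕ → ℕ} (he_pos : ∀ p : ℕ, p.Prime → 2 < p → 0 < e p)
    (he : Tendsto (fun p : ℕ ↦ log (e p) / log p)
      (atTop ⊓ 𝓟 {p : ℕ | p.Prime ∧ 2 < p}) (𝓝 0))
    (hup : ∀ p : ℕ, p.Prime → 2 < p →
      (1 - 1 / (p : ℝ))⁻¹ * (φ (p ^ e p) / (p : ℝ) ^ e p) ≤ 1 + 1 / ((p : ℝ) - 1) ^ 2)
    (hG : Multipliable fun p : Nat.Primes ↦
      (1 - 1 / (p : ℝ))⁻¹ * ⨅ k : ℕ, φ ((p : ℕ) ^ k) / (p : ℝ) ^ k) {c : ℝ}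
    (hc : exp (-eulerMascheroniConstant) * ∏' p : Nat.Primes,
      (1 - 1 / (p : ℝ))⁻¹ * ⨅ k : ℕ, φ ((p : ℕ) ^ k) / (p : ℝ) ^ k < c) :
    ∃ᶠ n : ℕ in atTop, φ n / n * log (log n) ≤ c := by
  obtain ⟨K, hK2, b, δ, hδ, hlt⟩ :=
    exists_prod_primesLE_mul_exp_lt (r := fun p k ↦ φ (p ^ k) / (p : ℝ) ^ k) hr hG hc
  obtain ⟨C, hC, heC⟩ := exists_le_mul_rpow_of_tendsto_log_div_log he hδ
  have hb0 : (0 : ℝ) ≤ ∑ i ∈ Finset.range (K + 1), (b i : ℝ) := by positivity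
  have hinv (p : ℕ) (hp : p.Prime) : 0 ≤ (1 - 1 / (p : ℝ))⁻¹ :=
    inv_nonneg.2 (by linarith [inv_prime_le_half hp])
  refine frequently_map_div_mul_log_log_le h1 hm hφ (a := fun p ↦ if p ≤ K then b p else e p) hδ
    (add_pos_of_pos_of_nonneg hC hb0) (fun p hp ↦ ?_) ?_ ?_ hlt
  · have hpδ : 1 ≤ (p : ℝ) ^ δ := one_le_rpow (by exact_mod_cast hp.one_le) hδ.le
    rw [add_mul]
    by_cases h : p ≤ K
    · rw [if_pos h]
      have : (b p : ℝ) ≤ ∑ i ∈ Finset.range (K + 1), (b i : ℝ) :=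
        Finset.single_le_sum (f := fun i ↦ (b i : ℝ)) (fun _ _ ↦ Nat.cast_nonneg _)
          (Finset.mem_range.2 (by omega))
      nlinarith
    · rw [if_neg h]
      have := heC p hp (by omega)
      nlinarith
  · filter_upwards [eventually_gt_atTop K] with p hpK hp
    rw [if_neg (by omega)]
    exact he_pos p hp (by omega)
  · filter_upwards [eventually_ge_atTop K] with y hy
    refine (prod_primesLE_le_mul_exp (fun p hp ↦ mul_nonneg (hinv p hp) (hr p _))
      (fun p hp hpK ↦ ?_) hy).trans_eq ?_
    · rw [if_neg (by omega)]
      exact hup p hp (by omega)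
    · congr 1
      exact Finset.prod_congr rfl fun p hp ↦ by rw [if_pos (Nat.mem_primesLE.1 hp).1]

/-- **Theorem 7 (Tóth–Wirsing).** Let `A` be a multiplicative divisor system with
`n ∈ A n` for all `n`, `φ_A` the unique multiplicative solution of
`∑_{d ∈ A(n)} φ_A(d) = n`, and assume that for each prime `p > 2` there is an
exponent `e p = p^{o(1)}` with `p^{e p - 1} ∈ A (p^{e p})`.  Then
`liminf φ_A(n) log log n / n = e^{-γ} ∏_p (1-1/p)⁻¹ inf_ν φ_A(p^ν)/p^ν`;
the product converges over the primes `p > 2` (the factor at `p = 2` may vanish). -/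
theorem liminf_phiA_eq
    (A : ℕ → Finset ℕ)
    (hdvd : ∀ n : ℕ, 1 ≤ n → ∀ d ∈ A n, d ∣ n)
    (hmul : ∀ m n : ℕ, 1 ≤ m → 1 ≤ n → Nat.Coprime m n → A (m * n) = A m * A n)
    (hself : ∀ n : ℕ, 1 ≤ n → n ∈ A n)
    (φ : ℕ → ℝ)
    (hφsum : ∀ n : ℕ, 1 ≤ n → ∑ d ∈ A n, φ d = n)
    (hφ1 : φ 1 = 1)
    (hφm : ∀ m n : ℕ, 1 ≤ m → 1 ≤ n → Nat.Coprime m n → φ (m * n) = φ m * φ n)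
    (hφbd : ∀ n : ℕ, 1 ≤ n → 1 ≤ φ n ∧ φ n ≤ n)
    (e : ℕ → ℕ) (he_pos : ∀ p : ℕ, p.Prime → 2 < p → 0 < e p)
    (hmem : ∀ p : ℕ, p.Prime → 2 < p → p ^ (e p - 1) ∈ A (p ^ e p))
    (he : Filter.Tendsto (fun p : ℕ => Real.log (e p) / Real.log p)
      (Filter.atTop ⊓ Filter.principal {p : ℕ | p.Prime ∧ 2 < p}) (nhds 0)) :
    Multipliable (fun p : {q : Nat.Primes // 2 < (q : ℕ)} =>
      (1 - 1 / (((p : Nat.Primes) : ℕ) : ℝ))⁻¹ *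
        ⨅ ν : ℕ, φ (((p : Nat.Primes) : ℕ) ^ ν) / (((p : Nat.Primes) : ℕ) : ℝ) ^ ν) ∧
    Filter.liminf (fun n : ℕ => φ n * Real.log (Real.log n) / n) Filter.atTop =
      Real.exp (-Real.eulerMascheroniConstant) *
        ∏' p : Nat.Primes, ((1 - 1 / (((p : Nat.Primes) : ℕ) : ℝ))⁻¹ *
          ⨅ ν : ℕ, φ (((p : Nat.Primes) : ℕ) ^ ν) / (((p : Nat.Primes) : ℕ) : ℝ) ^ ν) := by
  have hφ0 (n : ℕ) (hn : 1 ≤ n) : 0 ≤ φ n := by linarith [(hφbd n hn).1]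
  have hr0 (p k : ℕ) : 0 ≤ φ (p ^ k) / (p : ℝ) ^ k := by
    rcases Nat.eq_zero_or_pos p with rfl | hp
    · rcases Nat.eq_zero_or_pos k with rfl | hk
      · simp [hφ1]
      · simp [hk.ne']
    · exact div_nonneg (hφ0 _ (Nat.one_le_pow _ _ hp)) (by positivity)
  have hbdd (p : ℕ) : BddBelow (Set.range fun k : ℕ ↦ φ (p ^ k) / (p : ℝ) ^ k) :=
    ⟨0, by rintro _ ⟨k, rfl⟩; exact hr0 p k⟩
  set m : ℕ → ℝ := fun p ↦ ⨅ k : ℕ, φ (p ^ k) / (p : ℝ) ^ k with hm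
  have hm0 (p : ℕ) (_ : p.Prime) : 0 ≤ m p := le_ciInf (hr0 p)
  have hm1 (p : ℕ) (_ : p.Prime) : m p ≤ 1 :=
    (ciInf_le (hbdd p) 0).trans_eq (by simp [hφ1])
  have hmlow (p : ℕ) (hp : p.Prime) : 1 - 1 / ((p : ℝ) - 1) ≤ m p :=
    le_ciInf (one_sub_le_map_prime_pow_div hdvd hself hφsum hφbd hp)
  have hre (p : ℕ) (hp : p.Prime) (hp2 : 2 < p) :
      φ (p ^ e p) / (p : ℝ) ^ e p ≤ 1 - 1 / p + 1 / (p * ((p : ℝ) - 1)) := by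
    obtain ⟨k, hk⟩ := Nat.exists_eq_add_of_lt (he_pos p hp hp2)
    rw [zero_add] at hk
    have := hmem p hp hp2
    rw [hk] at this ⊢
    exact map_prime_pow_div_le hdvd hself hφsum hφbd hp this
  have hmup (p : ℕ) (hp : p.Prime) : m p ≤ 1 - 1 / p + 1 / (p * ((p : ℝ) - 1)) := by
    rcases hp.two_le.eq_or_lt with rfl | hp2
    · exact (hm1 2 hp).trans_eq (by norm_num)
    · exact (ciInf_le (hbdd p) (e p)).trans (hre p hp hp2)
  have hGabs (p : ℕ) (hp : p.Prime) :
      |(1 - 1 / (p : ℝ))⁻¹ * m p - 1| ≤ 1 / ((p : ℝ) - 1) ^ 2 :=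
    abs_euler_factor_sub_one_le hp (hmlow p hp) (hmup p hp)
  have hG : Multipliable fun p : Nat.Primes ↦ (1 - 1 / (p : ℝ))⁻¹ * m p :=
    multipliable_of_abs_sub_one_le (g := fun p : Nat.Primes ↦ (p : ℕ)) Subtype.val_injective
      fun p ↦ hGabs p p.2
  have hup (p : ℕ) (hp : p.Prime) (hp2 : 2 < p) :
      (1 - 1 / (p : ℝ))⁻¹ * (φ (p ^ e p) / (p : ℝ) ^ e p) ≤ 1 + 1 / ((p : ℝ) - 1) ^ 2 := by
    have := le_of_abs_le (abs_euler_factor_sub_one_le hp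
      (one_sub_le_map_prime_pow_div hdvd hself hφsum hφbd hp _) (hre p hp hp2))
    linarith
  refine ⟨multipliable_of_abs_sub_one_le
    (g := fun p : {q : Nat.Primes // 2 < (q : ℕ)} ↦ ((p : Nat.Primes) : ℕ))
    (Subtype.val_injective.comp Subtype.val_injective) fun p ↦ hGabs p p.1.2, ?_⟩
  obtain ⟨l, hl, hle⟩ := exists_tendsto_le_mul_log_log (f := fun n ↦ φ n / n) hm0 hm1 hmlow hG
    fun n hn ↦ by
      rw [map_div_eq_prod_primeFactors hφ1 hφm hn]
      exact Finset.prod_le_prod (fun p hp ↦ hm0 p (Nat.prime_of_mem_primeFactors hp))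
        fun p _ ↦ ciInf_le (hbdd p) _
  have hfreq {c : ℝ} := frequently_map_div_mul_log_log_le_of_lt (c := c) hφ1 hφm hr0 hφ0 he_pos he
    hup hG
  simp only [mul_div_right_comm]
  have hbl : IsBoundedUnder (· ≥ ·) atTop fun n : ℕ ↦ φ n / n * log (log n) :=
    hl.isBoundedUnder_ge.mono_ge hle
  refine le_antisymm (le_of_forall_gt_imp_ge_of_dense fun c hc ↦
    liminf_le_of_frequently_le (hfreq hc) hbl) ?_
  rw [← hl.liminf_eq]
  exact liminf_le_liminf hle hl.isBoundedUnder_ge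
    (IsCobounded.of_frequently_le (hfreq (lt_add_one _)))
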